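/- Assume gcd(N, M) = 1, let ρ : Matrix S S ℂ, and let ñ ∈ S satisfy μ(ñ) = 0. Define the orbit matrix A : Matrix (ZMod M) (ZMod M) ℂ by A[m,m'] = ρ[σ^m ñ, σ^{m'} ñ]. Then A = (1/M) · Σ_{k,l ∈ ZMod M} t_{k,l} • (L_{k, N·l})ᴴ, where t_{k,l} = Σ_{m,m' ∈ ZMod M} Λ_{k,l}[σ^m ñ, σ^{m'} ñ] · ρ[σ^{m'} ñ, σ^m ñ] is the trace of Λ_{k,l} against the block of ρ on the orbit of ñ. -/

import Mathlib

open Matrix Complex BigOperators Finset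

noncomputable section

set_option linter.unusedVariables false

/-- `ω = exp(2πi/M)`. -/
def hwOmega (M : ℕ) : ℂ := Complex.exp (2 * Real.pi * Complex.I / M)

/-- Single-photon Heisenberg–Weyl matrix `L_{k,l} = X^k Z^l`,
with entries `L_{k,l}[m,m'] = ω^{l·m'}` if `m = m' + k` and `0` otherwise. -/
def HW (M : ℕ) [NeZero M] (k l : ZMod M) : Matrix (ZMod M) (ZMod M) ℂ :=
  Matrix.of fun m m' => if m = m' + k then hwOmega M ^ (l * m').val else 0

/-- Fock vectors: mode-occupation functions `ZMod M → ℕ` with total photon number `N`. -/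
abbrev Fock (M N : ℕ) [NeZero M] := {n : ZMod M → ℕ // ∑ m, n m = N}

instance (M N : ℕ) [NeZero M] : Fintype (Fock M N) :=
  Fintype.ofInjective
    (fun n (m : ZMod M) => (⟨n.1 m, Nat.lt_succ_of_le (le_of_le_of_eq
      (Finset.single_le_sum (fun i _ => Nat.zero_le _) (Finset.mem_univ m)) n.2)⟩ : Fin (N+1)))
    (fun a b h => Subtype.ext (funext fun m => congrArg Fin.val (congrFun h m)))

/-- The mode shift `σ`, `(σ n)(m) = n(m - 1)`. -/
def modeShift (M N : ℕ) [NeZero M] (n : Fock M N) : Fock M N :=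
  ⟨fun m => n.1 (m - 1), by
    exact (Fintype.sum_equiv (Equiv.subRight (1 : ZMod M)) _ _ (fun m => rfl)).trans n.2⟩

/-- The total mode index `μ(n) = ∑ m, m·n(m) ∈ ZMod M`. -/
def tmi (M N : ℕ) [NeZero M] (n : Fock M N) : ZMod M := ∑ m : ZMod M, m * (n.1 m : ZMod M)

/-- Multiphoton Heisenberg–Weyl matrix `Λ_{k,l}`, with entries `ω^{l·μ(n)}` at `(σ^k n, n)`
and `0` elsewhere. -/
def HWm (M N : ℕ) [NeZero M] (k l : ZMod M) : Matrix (Fock M N) (Fock M N) ℂ :=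
  Matrix.of fun v n =>
    if v = (modeShift M N)^[k.val] n then hwOmega M ^ (l * tmi M N n).val else 0

theorem hwOmega_pow_val (M : ℕ) [NeZero M] (a : ZMod M) :
    hwOmega M ^ a.val = ZMod.stdAddChar a := by
  rw [ZMod.stdAddChar_apply, ZMod.toCircle_apply, hwOmega, ← Complex.exp_nat_mul]
  congr 1
  ring

theorem modeShift_iterate_apply (M N : ℕ) [NeZero M] (j : ℕ) (n : Fock M N) (x : ZMod M) :
    ((modeShift M N)^[j] n).1 x = n.1 (x - j) := by
  induction j generalizing x with
  | zero => simp
  | succ j ih =>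
    rw [Function.iterate_succ_apply']
    change ((modeShift M N)^[j] n).1 (x - 1) = _
    rw [ih]
    exact congrArg n.1 (by push_cast; ring)

theorem modeShift_iterate_val_add (M N : ℕ) [NeZero M] (k m : ZMod M) (n : Fock M N) :
    (modeShift M N)^[k.val] ((modeShift M N)^[m.val] n) = (modeShift M N)^[(m + k).val] n := by
  ext x
  simp only [modeShift_iterate_apply, ZMod.natCast_val, ZMod.cast_id', id]
  exact congrArg n.1 (by ring)

theorem tmi_modeShift_iterate (M N : ℕ) [NeZero M] (m : ZMod M) (n : Fock M N) :
    tmi M N ((modeShift M N)^[m.val] n) = tmi M N n + N * m := by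
  have hn : (∑ x, (n.1 x : ZMod M)) = N := by
    rw [← Nat.cast_sum, n.2]
  unfold tmi
  simp only [modeShift_iterate_apply, ZMod.natCast_val, ZMod.cast_id', id]
  rw [← Equiv.sum_comp (Equiv.addRight m), ← hn, Finset.sum_mul, ← Finset.sum_add_distrib]
  refine Finset.sum_congr rfl fun x _ => ?_
  simp only [Equiv.coe_addRight, add_sub_cancel_right]
  ring

theorem modeShift_orbit_injective (M N : ℕ) [NeZero M] (hgcd : Nat.gcd N M = 1) (n : Fock M N) :
    Function.Injective fun m : ZMod M => (modeShift M N)^[m.val] n := by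
  intro a b h
  have h' := congrArg (tmi M N) h
  simp only [tmi_modeShift_iterate] at h'
  exact ((ZMod.isUnit_iff_coprime N M).2 hgcd).mul_left_cancel (add_left_cancel h')

theorem HWm_orbit_apply (M N : ℕ) [NeZero M] (hgcd : Nat.gcd N M = 1) (n : Fock M N)
    (hn : tmi M N n = 0) (k l m m' : ZMod M) :
    HWm M N k l ((modeShift M N)^[m.val] n) ((modeShift M N)^[m'.val] n) =
      HW M k (N * l) m m' := by
  simp only [HWm, HW, Matrix.of_apply, modeShift_iterate_val_add, tmi_modeShift_iterate, hn,
    zero_add, (modeShift_orbit_injective M N hgcd n).eq_iff]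
  rw [show l * ((N : ZMod M) * m') = N * l * m' by ring]

theorem sum_stdAddChar_mul_star (M N : ℕ) [NeZero M] (hgcd : Nat.gcd N M = 1) (c a : ZMod M) :
    ∑ l : ZMod M, (ZMod.stdAddChar ((N : ZMod M) * l * c) : ℂ) *
      star (ZMod.stdAddChar ((N : ZMod M) * l * a) : ℂ) = if c = a then (M : ℂ) else 0 := by
  have h := AddChar.sum_mulShift ((N : ZMod M) * (c - a)) (ZMod.isPrimitive_stdAddChar M)
  have hz : (N : ZMod M) * (c - a) = 0 ↔ c = a := by
    rw [((ZMod.isUnit_iff_coprime N M).2 hgcd).mul_right_eq_zero, sub_eq_zero]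
  simp only [hz, ZMod.card, Nat.cast_ite, Nat.cast_zero] at h
  rw [← h]
  refine Finset.sum_congr rfl fun l _ => ?_
  rw [← starRingEnd_apply, ← AddChar.map_neg_eq_conj, ← AddChar.map_add_eq_mul]
  congr 1
  ring

/-- Heisenberg–Weyl expansion of a matrix, with the phase index rescaled by a unit `N`. -/
theorem HW_reconstruction (M N : ℕ) [NeZero M] (hgcd : Nat.gcd N M = 1)
    (A : Matrix (ZMod M) (ZMod M) ℂ) :
    A = (1 / (M : ℂ)) • ∑ k : ZMod M, ∑ l : ZMod M,
      (∑ m : ZMod M, ∑ m' : ZMod M, HW M k (N * l) m m' * A m' m) • (HW M k (N * l))ᴴ := by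
  ext a b
  have hM : (M : ℂ) ≠ 0 := Nat.cast_ne_zero.2 (NeZero.ne M)
  have key (k : ZMod M) : (∑ l : ZMod M,
      (∑ m : ZMod M, ∑ m' : ZMod M, HW M k (N * l) m m' * A m' m) * star (HW M k (N * l) b a)) =
      if b = a + k then (M : ℂ) * A a b else 0 := by
    simp only [HW, Matrix.of_apply, hwOmega_pow_val]
    by_cases hk : b = a + k
    · subst hk
      simp only [if_true, ite_mul, zero_mul]
      rw [Finset.sum_congr rfl fun l _ => by rw [Finset.sum_comm]]
      simp only [Finset.sum_ite_eq', Finset.mem_univ, if_true, Finset.sum_mul]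
      rw [Finset.sum_comm]
      have hs (c : ZMod M) : (∑ l : ZMod M, (ZMod.stdAddChar ((N : ZMod M) * l * c) : ℂ) *
          A c (c + k) * star (ZMod.stdAddChar ((N : ZMod M) * l * a) : ℂ)) =
          (if c = a then (M : ℂ) else 0) * A c (c + k) := by
        rw [← sum_stdAddChar_mul_star M N hgcd, Finset.sum_mul]
        exact Finset.sum_congr rfl fun l _ => mul_right_comm _ _ _
      simp only [hs]
      simp
    · simp [hk]
  have hb (k : ZMod M) : b = a + k ↔ b - a = k := by rw [sub_eq_iff_eq_add']
  simp only [Matrix.smul_apply, Matrix.sum_apply, Matrix.conjTranspose_apply, smul_eq_mul, key]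
  simp [hb, hM]

/-- the orbit block `A[m,m'] = ρ[σ^m ñ, σ^{m'} ñ]` of `ρ` is reconstructed from
the traces `t_{k,l}` of `Λ_{k,l}` against the block: `A = (1/M) Σ_{k,l} t_{k,l} • (L_{k,Nl})ᴴ`. -/
theorem orbit_block_reconstruction (M N : ℕ) [NeZero M] (hN : 1 ≤ N)
    (hgcd : Nat.gcd N M = 1) (ρ : Matrix (Fock M N) (Fock M N) ℂ)
    (t : Fock M N) (ht : tmi M N t = 0) :
    (Matrix.of fun m m' : ZMod M =>
        ρ ((modeShift M N)^[m.val] t) ((modeShift M N)^[m'.val] t)) =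
      (1 / (M : ℂ)) • ∑ k : ZMod M, ∑ l : ZMod M,
        (∑ m : ZMod M, ∑ m' : ZMod M,
          HWm M N k l ((modeShift M N)^[m.val] t) ((modeShift M N)^[m'.val] t) *
            ρ ((modeShift M N)^[m'.val] t) ((modeShift M N)^[m.val] t)) •
          (HW M k ((N : ZMod M) * l))ᴴ := by
  simp only [HWm_orbit_apply M N hgcd t ht]
  exact HW_reconstruction M N hgcd _

end
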